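/- The map M defined on partitions as follows is a bijection from the set of all partitions onto the set of partitions with distinct parts: for a partition μ with Durfee size d, M(μ) is the partition whose (2i−1)-th part is μ_i + μ'_i − 2i + 1 for 1 ≤ i ≤ d, whose (2i)-th part is μ_i + μ'_{i+1} − 2i for those 1 ≤ i ≤ d with μ_i ≥ i + 1, and which has no further parts (M of the empty partition is the empty partition). -/

import Mathlib

/-- A partition: a weakly decreasing sequence of naturals with finite support.
`p.parts i` is the `(i+1)`-st part, i.e. parts are 0-indexed (`λ_1 = p.parts 0`). -/
structure Ptn where
  parts : ℕ → ℕ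
  antitone' : ∀ ⦃i j : ℕ⦄, i ≤ j → parts j ≤ parts i
  finite_support' : (Function.support parts).Finite

namespace Ptn

/-- The size `|λ|` of a partition: the sum of all its parts. -/
noncomputable def size (p : Ptn) : ℕ := ∑ᶠ i, p.parts i

/-- The number of (nonzero) parts `ℓ(λ)`. -/
noncomputable def length (p : Ptn) : ℕ := (Function.support p.parts).ncard

/-- A partition has distinct parts if no nonzero value is repeated. -/
def Distinct (p : Ptn) : Prop := ∀ i : ℕ, p.parts (i + 1) ≠ 0 → p.parts (i + 1) < p.parts i

/-- A partition has odd parts if every part is odd. -/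
def OddParts (p : Ptn) : Prop := ∀ i : ℕ, p.parts i ≠ 0 → Odd (p.parts i)

end Ptn

namespace Ptn

/-- The conjugate partition evaluated 1-based: `conj p i = λ'_i = #{j : λ_j ≥ i}`
(meaningful for `i ≥ 1`). -/
noncomputable def conj (p : Ptn) (i : ℕ) : ℕ := {j : ℕ | i ≤ p.parts j}.ncard

/-- The Durfee size: the largest `i` with `λ_i ≥ i` (1-based), i.e. the number of
0-based indices `i` with `parts i ≥ i + 1`. -/
noncomputable def durfee (p : Ptn) : ℕ := {i : ℕ | i + 1 ≤ p.parts i}.ncard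

/-- The `i`-th diagonal hook length (1-based, for `1 ≤ i ≤ durfee p`):
`h_i(λ) = λ_i + λ'_i - 2i + 1`. -/
noncomputable def hook (p : Ptn) (i : ℕ) : ℕ := p.parts (i - 1) + p.conj i + 1 - 2 * i

end Ptn

/-- The number of parts of the image of `μ` under Mork's bijection:
`2d` if `μ_d ≥ d + 1` and `2d - 1` otherwise, where `d` is the Durfee size
(this is `0` for the empty partition). -/
noncomputable def morkLength (p : Ptn) : ℕ :=
  if p.durfee + 1 ≤ p.parts (p.durfee - 1) then 2 * p.durfee else 2 * p.durfee - 1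

theorem Set.Finite.mem_iff_lt_ncard_of_isLowerSet {s : Set ℕ} (hs : s.Finite)
    (hl : IsLowerSet s) (j : ℕ) : j ∈ s ↔ j < s.ncard := by
  classical
  have hex : ∃ n, n ∉ s := hs.exists_notMem
  have hn : s = (Finset.range (Nat.find hex) : Set ℕ) := by
    ext k
    simp only [Finset.coe_range, Set.mem_Iio]
    refine ⟨fun hk => ?_, fun hk => not_not.mp (Nat.find_min hex hk)⟩
    by_contra hlt
    exact Nat.find_spec hex (hl (not_lt.mp hlt) hk)
  have hcard : s.ncard = Nat.find hex := by
    conv_lhs => rw [hn]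
    rw [Set.ncard_coe_finset, Finset.card_range]
  rw [hcard]
  conv_lhs => rw [hn]
  simp

/-- A sequence that eventually vanishes is determined by the sums of its consecutive terms. -/
theorem eq_of_add_succ_eq {S T : ℕ → ℕ} {N : ℕ} (hS : ∀ m, N ≤ m → S m = 0)
    (hT : ∀ m, N ≤ m → T m = 0) (h : ∀ m, S m + S (m + 1) = T m + T (m + 1)) : S = T := by
  have key : ∀ k m, N ≤ m + k → S m = T m := by
    intro k
    induction k with
    | zero => intro m hm; rw [hS m hm, hT m hm]
    | succ k ih =>
      intro m hm
      have h1 := ih (m + 1) (by omega)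
      have h2 := h m
      omega
  funext m
  exact key N m (by omega)

/-- The alternating tail sums of an antitone sequence with finite support. -/
theorem exists_add_succ_eq (N : ℕ) (L : ℕ → ℕ) (hL : Antitone L) (hN : ∀ m, N ≤ m → L m = 0) :
    ∃ S : ℕ → ℕ, (∀ m, S m + S (m + 1) = L m) ∧ ∀ m, N ≤ m → S m = 0 := by
  induction N generalizing L with
  | zero => exact ⟨fun _ => 0, fun m => (hN m (Nat.zero_le m)).symm, fun _ _ => rfl⟩
  | succ N ih =>
    obtain ⟨S, hS, hS0⟩ := ih (fun m => L (m + 1)) (fun a b hab => hL (by omega))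
      (fun m hm => hN _ (by omega))
    refine ⟨fun m => Nat.casesOn m (L 0 - S 0) S, fun m => ?_, fun m hm => ?_⟩
    · cases m with
      | zero =>
        have h1 : S 0 + S 1 = L 1 := hS 0
        have h2 : L 1 ≤ L 0 := hL (by omega)
        change L 0 - S 0 + S 0 = L 0
        omega
      | succ m => exact hS m
    · cases m with
      | zero => omega
      | succ m => exact hS0 m (by omega)

namespace Ptn

theorem parts_injective : Function.Injective parts := by
  rintro ⟨a, _, _⟩ ⟨b, _, _⟩ h
  cases h
  rfl

theorem lt_conj_succ_iff (p : Ptn) (i j : ℕ) : j < p.conj (i + 1) ↔ i < p.parts j := by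
  refine (Set.Finite.mem_iff_lt_ncard_of_isLowerSet (s := {j | i + 1 ≤ p.parts j})
    (p.finite_support'.subset fun k hk => ?_) (fun a b hba ha => ?_) j).symm
  · simp only [Set.mem_ofPred_eq, Function.mem_support] at hk ⊢
    omega
  · exact le_trans ha (p.antitone' hba)

theorem lt_durfee_iff (p : Ptn) (i : ℕ) : i < p.durfee ↔ i < p.parts i := by
  refine (Set.Finite.mem_iff_lt_ncard_of_isLowerSet (s := {i | i + 1 ≤ p.parts i})
    (p.finite_support'.subset fun k hk => ?_) (fun a b hba ha => ?_) i).symm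
  · simp only [Set.mem_ofPred_eq, Function.mem_support] at hk ⊢
    omega
  · simp only [Set.mem_ofPred_eq] at ha ⊢
    have := p.antitone' hba
    omega

/-- The legs of the diagonal cells (counting the cell itself) interleaved with their arms. -/
noncomputable def legArm (p : Ptn) (m : ℕ) : ℕ :=
  if Even m then p.conj (m / 2 + 1) - m / 2 else p.parts (m / 2) - (m / 2 + 1)

theorem legArm_two_mul (p : Ptn) (i : ℕ) : p.legArm (2 * i) = p.conj (i + 1) - i := by
  simp [legArm]

theorem legArm_two_mul_add_one (p : Ptn) (i : ℕ) :
    p.legArm (2 * i + 1) = p.parts i - (i + 1) := by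
  have h : (2 * i + 1) / 2 = i := by omega
  simp [legArm, h]

theorem legArm_eq_zero (p : Ptn) {m : ℕ} (hm : 2 * p.durfee ≤ m) : p.legArm m = 0 := by
  obtain ⟨i, rfl | rfl⟩ := m.even_or_odd'
  · rw [legArm_two_mul]
    have h1 := p.lt_durfee_iff i
    have h2 := p.lt_conj_succ_iff i i
    omega
  · rw [legArm_two_mul_add_one]
    have h1 := p.lt_durfee_iff i
    omega

theorem eq_of_legArm_eq {p q : Ptn} (h : p.legArm = q.legArm) : p = q := by
  apply parts_injective
  funext j
  apply eq_of_forall_lt_iff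
  intro i
  rcases le_or_gt i j with hij | hij
  · have h1 := congrFun h (2 * i)
    rw [legArm_two_mul, legArm_two_mul] at h1
    rw [← lt_conj_succ_iff, ← lt_conj_succ_iff]
    omega
  · have h1 := congrFun h (2 * j + 1)
    rw [legArm_two_mul_add_one, legArm_two_mul_add_one] at h1
    omega

theorem legArm_add_two_lt (p : Ptn) (m : ℕ) (h : 0 < p.legArm (m + 1) + p.legArm (m + 2)) :
    p.legArm (m + 2) < p.legArm m := by
  obtain ⟨i, rfl | rfl⟩ := m.even_or_odd'
  · rw [show 2 * i + 2 = 2 * (i + 1) by ring] at h ⊢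
    rw [legArm_two_mul] at h ⊢
    rw [legArm_two_mul_add_one] at h
    rw [legArm_two_mul]
    have h1 := p.lt_conj_succ_iff i i
    have h2 := p.lt_conj_succ_iff (i + 1) (i + 1)
    have h3 := p.antitone' (Nat.le_succ i)
    have h4 : p.conj (i + 1 + 1) ≤ p.conj (i + 1) := by
      refine le_of_forall_lt fun k hk => ?_
      rw [lt_conj_succ_iff] at hk ⊢
      omega
    simp only [Nat.succ_eq_add_one] at h3
    omega
  · rw [show 2 * i + 1 + 1 = 2 * (i + 1) by ring,
      show 2 * i + 1 + 2 = 2 * (i + 1) + 1 by ring] at h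
    rw [show 2 * i + 1 + 2 = 2 * (i + 1) + 1 by ring]
    rw [legArm_two_mul, legArm_two_mul_add_one] at h
    rw [legArm_two_mul_add_one, legArm_two_mul_add_one]
    have h2 := p.lt_conj_succ_iff (i + 1) (i + 1)
    have h3 := p.antitone' (Nat.le_succ i)
    simp only [Nat.succ_eq_add_one] at h3
    omega

/-- The partition whose parts are the row lengths of a Young diagram. -/
def ofYoungDiagram (Y : YoungDiagram) : Ptn where
  parts := Y.rowLen
  antitone' _ _ h := Y.rowLen_anti _ _ h
  finite_support' := by
    refine (Set.finite_Iio (Y.colLen 0)).subset fun j hj => ?_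
    rw [Function.mem_support, ← Nat.pos_iff_ne_zero, ← YoungDiagram.mem_iff_lt_rowLen] at hj
    exact YoungDiagram.mem_iff_lt_colLen.mp hj

theorem exists_legArm_eq {S : ℕ → ℕ} {N : ℕ} (hN : ∀ m, N ≤ m → S m = 0)
    (hS : ∀ m, 0 < S (m + 1) + S (m + 2) → S (m + 2) < S m) : ∃ p : Ptn, p.legArm = S := by
  classical
  let cell : ℕ → ℕ → Prop := fun j i => if i ≤ j then j < i + S (2 * i) else i ≤ j + S (2 * j + 1)
  have hrow : ∀ j i, cell (j + 1) i → cell j i := by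
    intro j i h
    have h1 := hS (2 * j + 1)
    rw [show 2 * j + 1 + 1 = 2 * (j + 1) by ring,
      show 2 * j + 1 + 2 = 2 * (j + 1) + 1 by ring] at h1
    by_cases hi : i = j + 1
    · subst hi
      simp only [cell] at h ⊢
      split_ifs at h ⊢ <;> omega
    · simp only [cell] at h ⊢
      split_ifs at h ⊢ <;> omega
  have hcol : ∀ j i, cell j (i + 1) → cell j i := by
    intro j i h
    have h1 := hS (2 * i)
    rw [show 2 * i + 2 = 2 * (i + 1) by ring] at h1
    by_cases hi : i = j
    · subst hi
      simp only [cell] at h ⊢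
      split_ifs at h ⊢ <;> omega
    · simp only [cell] at h ⊢
      split_ifs at h ⊢ <;> omega
  have hrow' : ∀ i, Antitone fun j => cell j i := fun i => antitone_nat_of_succ_le (hrow · i)
  have hcol' : ∀ j, Antitone (cell j) := fun j => antitone_nat_of_succ_le (hcol j)
  have hd : ∀ k, cell k k → k < N := by
    intro k hk
    by_contra hlt
    have := hN (2 * k) (by omega)
    simp only [cell, le_refl, if_true] at hk
    omega
  obtain ⟨B, hB⟩ : ∃ B, ∀ m, S m ≤ B := by
    refine ⟨∑ m ∈ Finset.range N, S m, fun m => ?_⟩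
    rcases lt_or_ge m N with hm | hm
    · exact Finset.single_le_sum (f := S) (fun _ _ => Nat.zero_le _) (Finset.mem_range.mpr hm)
    · simp [hN m hm]
  have hbd : ∀ j i, cell j i → j < N + B + 1 ∧ i < N + B + 1 := by
    intro j i h
    rcases le_total i j with hij | hij
    · have h1 := hd i (hrow' i hij h)
      have h2 := hB (2 * i)
      simp only [cell, if_pos hij] at h
      omega
    · have h1 := hd j (hcol' j hij h)
      have h2 := hB (2 * j + 1)
      have h3 := hB (2 * i)
      simp only [cell] at h
      split_ifs at h <;> omega
  let Y : YoungDiagram :=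
    { cells := (Finset.range (N + B + 1) ×ˢ Finset.range (N + B + 1)).filter
        fun c => cell c.1 c.2
      isLowerSet := by
        rintro ⟨j, i⟩ ⟨j', i'⟩ ⟨hj, hi⟩ h
        simp only [Finset.coe_filter, Finset.mem_product, Finset.mem_range,
          Set.mem_ofPred_eq] at h ⊢
        have hc : cell j' i' := hcol' j' hi (hrow' i hj h.2)
        exact ⟨hbd _ _ hc, hc⟩ }
  have hY : ∀ i j, i < (ofYoungDiagram Y).parts j ↔ cell j i := by
    intro i j
    change i < Y.rowLen j ↔ _
    rw [← YoungDiagram.mem_iff_lt_rowLen, ← YoungDiagram.mem_cells]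
    simp only [Y, Finset.mem_filter, Finset.mem_product, Finset.mem_range]
    exact ⟨fun h => h.2, fun h => ⟨hbd _ _ h, h⟩⟩
  refine ⟨ofYoungDiagram Y, ?_⟩
  funext m
  apply eq_of_forall_lt_iff
  intro k
  obtain ⟨i, rfl | rfl⟩ := m.even_or_odd'
  · rw [legArm_two_mul, lt_tsub_iff_left, lt_conj_succ_iff, hY]
    simp [cell]
  · rw [legArm_two_mul_add_one, lt_tsub_iff_left, hY]
    simp only [cell]
    split_ifs <;> omega

end Ptn

/-- Mork's bijection: any map `M` on partitions such that, for each `μ` of Durfee size `d`,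
the `(2i-1)`-th part of `M μ` is `μ_i + μ'_i - 2i + 1` for `1 ≤ i ≤ d`, the `(2i)`-th part
is `μ_i + μ'_{i+1} - 2i` for those `1 ≤ i ≤ d` with `μ_i ≥ i + 1`, and `M μ` has no further
parts, is a bijection from the set of all partitions onto the set of partitions with
distinct parts. (Recall parts are 0-indexed: the `j`-th part of `M μ` is
`(M μ).parts (j - 1)`.) -/
theorem mork_bijection (M : Ptn → Ptn)
    (hodd : ∀ μ : Ptn, ∀ i, 1 ≤ i → i ≤ μ.durfee →
      (M μ).parts (2 * i - 2) = μ.parts (i - 1) + μ.conj i + 1 - 2 * i)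
    (heven : ∀ μ : Ptn, ∀ i, 1 ≤ i → i ≤ μ.durfee → i + 1 ≤ μ.parts (i - 1) →
      (M μ).parts (2 * i - 1) = μ.parts (i - 1) + μ.conj (i + 1) - 2 * i)
    (hzero : ∀ μ : Ptn, ∀ j, morkLength μ ≤ j → (M μ).parts j = 0) :
    Set.BijOn M Set.univ {p : Ptn | p.Distinct} := by
  have hM : ∀ μ : Ptn, ∀ m, (M μ).parts m = μ.legArm m + μ.legArm (m + 1) := by
    intro μ m
    obtain ⟨i, rfl | rfl⟩ := m.even_or_odd'
    · rcases lt_or_ge i μ.durfee with hi | hi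
      · have h1 := hodd μ (i + 1) (by omega) (by omega)
        rw [show 2 * (i + 1) - 2 = 2 * i by omega, Nat.add_sub_cancel] at h1
        rw [h1, Ptn.legArm_two_mul, Ptn.legArm_two_mul_add_one]
        have h2 := μ.lt_durfee_iff i
        have h3 := μ.lt_conj_succ_iff i i
        omega
      · rw [hzero μ (2 * i) (by unfold morkLength; split_ifs <;> omega),
          μ.legArm_eq_zero (by omega), μ.legArm_eq_zero (by omega)]
    · rcases lt_or_ge i μ.durfee with hi | hi
      · rw [show 2 * i + 1 + 1 = 2 * (i + 1) by ring, Ptn.legArm_two_mul_add_one,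
          Ptn.legArm_two_mul]
        have h2 := μ.lt_durfee_iff i
        have h3 := μ.lt_conj_succ_iff (i + 1) i
        rcases lt_or_ge (i + 1) (μ.parts i) with ha | ha
        · have h1 := heven μ (i + 1) (by omega) (by omega) ha
          rw [show 2 * (i + 1) - 1 = 2 * i + 1 by omega, Nat.add_sub_cancel] at h1
          rw [h1]
          omega
        · have h4 := μ.lt_durfee_iff (i + 1)
          have h5 := μ.antitone' (Nat.le_succ i)
          have h6 := μ.lt_conj_succ_iff (i + 1) (i + 1)
          simp only [Nat.succ_eq_add_one] at h5
          have hd : μ.durfee = i + 1 := by omega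
          rw [hzero μ (2 * i + 1)]
          · omega
          · rw [morkLength, hd, Nat.add_sub_cancel, if_neg (by omega)]
            omega
      · rw [hzero μ (2 * i + 1) (by unfold morkLength; split_ifs <;> omega),
          μ.legArm_eq_zero (by omega), μ.legArm_eq_zero (by omega)]
  refine ⟨fun μ _ i hi => ?_, fun μ _ ν _ h => ?_, fun L hL => ?_⟩
  · rw [hM] at hi
    rw [hM, hM]
    have := μ.legArm_add_two_lt i (Nat.pos_of_ne_zero hi)
    change μ.legArm (i + 1) + μ.legArm (i + 2) < _
    omega
  · refine Ptn.eq_of_legArm_eq (eq_of_add_succ_eq (N := 2 * μ.durfee + 2 * ν.durfee)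
      (fun m hm => μ.legArm_eq_zero (by omega)) (fun m hm => ν.legArm_eq_zero (by omega))
      fun m => ?_)
    rw [← hM, ← hM, h]
  · obtain ⟨N, hN⟩ := L.finite_support'.bddAbove
    have hzero' : ∀ m, N + 1 ≤ m → L.parts m = 0 := by
      intro m hm
      by_contra h
      have := hN (Function.mem_support.mpr h)
      omega
    obtain ⟨S, hS, hS0⟩ := exists_add_succ_eq (N + 1) L.parts (fun _ _ h => L.antitone' h) hzero'
    obtain ⟨p, hp⟩ := Ptn.exists_legArm_eq hS0 (fun m hm => by
      have h1 := hS m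
      have h2 : S (m + 1) + S (m + 2) = L.parts (m + 1) := hS (m + 1)
      have h3 := hL m (by omega)
      omega)
    refine ⟨p, Set.mem_univ p, Ptn.parts_injective (funext fun m => ?_)⟩
    rw [hM, hp, hS]
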